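/- arXiv:2409.06648 — 4 statements merged into one kernel-verified Lean document; each statement's English description precedes it below -/
import Mathlib

section
/- Under the monotone-tangent-angle hypotheses on γ, the curve stays weakly below the line through the origin with direction (cos θ₀, sin θ₀): for every t ∈ [0,1], sin(θ₀)·γ(t)₁ − cos(θ₀)·γ(t)₂ ≥ 0, where γ(t) = (γ(t)₁, γ(t)₂). -/
open Real Set

theorem curve_below_left_tangent_line
    (L θ₀ θL : ℝ) (hL : 0 < L)
    (hθ₀ : θ₀ ∈ Icc (0 : ℝ) (π / 2)) (hθL : θL ∈ Icc (0 : ℝ) (π / 2))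
    (γ : ℝ → ℝ × ℝ) (r θ : ℝ → ℝ)
    (hγ0 : γ 0 = (0, 0)) (hγ1 : γ 1 = (L, 0))
    (hr : ∀ t ∈ Icc (0 : ℝ) 1, 0 < r t)
    (hθanti : AntitoneOn θ (Icc (0 : ℝ) 1))
    (hθ0 : θ 0 = θ₀) (hθ1 : θ 1 = -θL)
    (hderiv : ∀ t ∈ Icc (0 : ℝ) 1,
      HasDerivWithinAt γ (r t • (Real.cos (θ t), Real.sin (θ t))) (Icc (0 : ℝ) 1) t) :
    ∀ t ∈ Icc (0 : ℝ) 1,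
      Real.sin θ₀ * (γ t).1 - Real.cos θ₀ * (γ t).2 ≥ 0 := by
  have h0 : (0 : ℝ) ∈ Icc (0 : ℝ) 1 := left_mem_Icc.2 zero_le_one
  have h1 : (1 : ℝ) ∈ Icc (0 : ℝ) 1 := right_mem_Icc.2 zero_le_one
  have hheight : ∀ t ∈ Icc (0 : ℝ) 1,
      HasDerivWithinAt (fun s => Real.sin θ₀ * (γ s).1 - Real.cos θ₀ * (γ s).2)
        (r t * Real.sin (θ₀ - θ t)) (Icc (0 : ℝ) 1) t := by
    intro t ht
    have hfst := (hasFDerivAt_fst (𝕜 := ℝ) (p := γ t)).comp_hasDerivWithinAt t (hderiv t ht)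
    have hsnd := (hasFDerivAt_snd (𝕜 := ℝ) (p := γ t)).comp_hasDerivWithinAt t (hderiv t ht)
    refine ((hfst.const_mul (Real.sin θ₀)).sub (hsnd.const_mul (Real.cos θ₀))).congr_deriv ?_
    simp only [ContinuousLinearMap.coe_fst', ContinuousLinearMap.coe_snd', Prod.smul_mk,
      smul_eq_mul, Real.sin_sub]
    ring
  have hmono : MonotoneOn (fun s => Real.sin θ₀ * (γ s).1 - Real.cos θ₀ * (γ s).2)
      (Icc (0 : ℝ) 1) := by
    refine monotoneOn_of_hasDerivWithinAt_nonneg (convex_Icc 0 1)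
      (fun t ht => (hheight t ht).continuousWithinAt)
      (fun t ht => (hheight t (interior_subset ht)).mono interior_subset) fun t ht => ?_
    have ht' := interior_subset ht
    have hle := hθanti h0 ht' ht'.1
    have hge := hθanti ht' h1 ht'.2
    exact mul_nonneg (hr t ht').le
      (Real.sin_nonneg_of_nonneg_of_le_pi (by linarith) (by linarith [hθ₀.2, hθL.2]))
  intro t ht
  simpa [hγ0] using hmono h0 ht ht.1
end

section
/- Under the monotone-tangent-angle hypotheses on γ, the curve stays weakly below the line through the point (L,0) with direction (−cos θ_L, sin θ_L): for every t ∈ [0,1], sin(θ_L)·(L − γ(t)₁) − cos(θ_L)·γ(t)₂ ≥ 0, where γ(t) = (γ(t)₁, γ(t)₂). -/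
open Real Set

theorem curve_below_right_tangent_line
    (L θ₀ θL : ℝ) (hL : 0 < L)
    (hθ₀ : θ₀ ∈ Icc (0 : ℝ) (π / 2)) (hθL : θL ∈ Icc (0 : ℝ) (π / 2))
    (γ : ℝ → ℝ × ℝ) (r θ : ℝ → ℝ)
    (hγ0 : γ 0 = (0, 0)) (hγ1 : γ 1 = (L, 0))
    (hr : ∀ t ∈ Icc (0 : ℝ) 1, 0 < r t)
    (hθanti : AntitoneOn θ (Icc (0 : ℝ) 1))
    (hθ0 : θ 0 = θ₀) (hθ1 : θ 1 = -θL)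
    (hderiv : ∀ t ∈ Icc (0 : ℝ) 1,
      HasDerivWithinAt γ (r t • (Real.cos (θ t), Real.sin (θ t))) (Icc (0 : ℝ) 1) t) :
    ∀ t ∈ Icc (0 : ℝ) 1,
      Real.sin θL * (L - (γ t).1) - Real.cos θL * (γ t).2 ≥ 0 := by
  have hderivF : ∀ t ∈ Icc (0 : ℝ) 1,
      HasDerivWithinAt (fun t => Real.sin θL * (L - (γ t).1) - Real.cos θL * (γ t).2)
        (-(r t * Real.sin (θ t + θL))) (Icc (0 : ℝ) 1) t := by
    intro t ht
    have h₁ : HasDerivWithinAt (fun t => (γ t).1) (r t * Real.cos (θ t)) (Icc (0 : ℝ) 1) t :=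
      (hasFDerivAt_fst (𝕜 := ℝ) (p := γ t)).comp_hasDerivWithinAt t (hderiv t ht)
    have h₂ : HasDerivWithinAt (fun t => (γ t).2) (r t * Real.sin (θ t)) (Icc (0 : ℝ) 1) t :=
      (hasFDerivAt_snd (𝕜 := ℝ) (p := γ t)).comp_hasDerivWithinAt t (hderiv t ht)
    refine (((h₁.const_sub L).const_mul (Real.sin θL)).sub
      (h₂.const_mul (Real.cos θL))).congr_deriv ?_
    rw [Real.sin_add]
    ring
  have hanti : AntitoneOn (fun t => Real.sin θL * (L - (γ t).1) - Real.cos θL * (γ t).2)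
      (Icc (0 : ℝ) 1) := by
    refine antitoneOn_of_hasDerivWithinAt_nonpos (convex_Icc 0 1)
      (fun t ht => (hderivF t ht).continuousWithinAt)
      (fun t ht => (hderivF t (interior_subset ht)).mono interior_subset) fun t ht => ?_
    have ht := interior_subset ht
    have hle := hθanti (left_mem_Icc.2 zero_le_one) ht ht.1
    have hge := hθanti ht (right_mem_Icc.2 zero_le_one) ht.2
    have hsin : 0 ≤ Real.sin (θ t + θL) :=
      Real.sin_nonneg_of_nonneg_of_le_pi (by linarith) (by linarith [hθ₀.2, hθL.2])
    exact neg_nonpos.2 (mul_nonneg (hr t ht).le hsin)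
  intro t ht
  simpa [hγ1] using hanti ht (right_mem_Icc.2 zero_le_one) ht.2
end

section
/- Under the monotone-tangent-angle hypotheses on γ, the curve stays weakly above the x-axis: for every t ∈ [0,1], the second coordinate satisfies γ(t)₂ ≥ 0. -/
open Real Set

theorem curve_above_x_axis
    (L θ₀ θL : ℝ) (hL : 0 < L)
    (hθ₀ : θ₀ ∈ Icc (0 : ℝ) (π / 2)) (hθL : θL ∈ Icc (0 : ℝ) (π / 2))
    (γ : ℝ → ℝ × ℝ) (r θ : ℝ → ℝ)
    (hγ0 : γ 0 = (0, 0)) (hγ1 : γ 1 = (L, 0))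
    (hr : ∀ t ∈ Icc (0 : ℝ) 1, 0 < r t)
    (hθanti : AntitoneOn θ (Icc (0 : ℝ) 1))
    (hθ0 : θ 0 = θ₀) (hθ1 : θ 1 = -θL)
    (hderiv : ∀ t ∈ Icc (0 : ℝ) 1,
      HasDerivWithinAt γ (r t • (Real.cos (θ t), Real.sin (θ t))) (Icc (0 : ℝ) 1) t) :
    ∀ t ∈ Icc (0 : ℝ) 1,
      (γ t).2 ≥ 0 := by
  intro t ht
  by_contra! hneg
  have hy : ∀ s ∈ Icc (0 : ℝ) 1,
      HasDerivWithinAt (fun u => (γ u).2) (r s * Real.sin (θ s)) (Icc (0 : ℝ) 1) s :=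
    fun s hs => (hderiv s hs).snd
  have hcont : ContinuousOn (fun u => (γ u).2) (Icc (0 : ℝ) 1) :=
    fun s hs => (hy s hs).continuousWithinAt
  have hy' : ∀ s ∈ Ioo (0 : ℝ) 1,
      HasDerivAt (fun u => (γ u).2) (r s * Real.sin (θ s)) s :=
    fun s hs => (hy s (Ioo_subset_Icc_self hs)).hasDerivAt (Icc_mem_nhds hs.1 hs.2)
  have ht0 : 0 < t := by
    refine lt_of_le_of_ne ht.1 fun h => ?_
    simp [← h, hγ0] at hneg
  have ht1 : t < 1 := by
    refine lt_of_le_of_ne ht.2 fun h => ?_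
    simp [h, hγ1] at hneg
  obtain ⟨c, hc, hc'⟩ := exists_hasDerivAt_eq_slope (fun u => (γ u).2)
    (fun s => r s * Real.sin (θ s)) ht0 (hcont.mono (Icc_subset_Icc_right ht.2))
    (fun s hs => hy' s ⟨hs.1, hs.2.trans ht1⟩)
  obtain ⟨d, hd, hd'⟩ := exists_hasDerivAt_eq_slope (fun u => (γ u).2)
    (fun s => r s * Real.sin (θ s)) ht1 (hcont.mono (Icc_subset_Icc_left ht.1))
    (fun s hs => hy' s ⟨ht0.trans hs.1, hs.2⟩)
  have hcI : c ∈ Icc (0 : ℝ) 1 := ⟨hc.1.le, (hc.2.trans ht1).le⟩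
  have hdI : d ∈ Icc (0 : ℝ) 1 := ⟨(ht0.trans hd.1).le, hd.2.le⟩
  have hsc : r c * Real.sin (θ c) < 0 := by
    rw [hc', hγ0]
    exact div_neg_of_neg_of_pos (by simpa using hneg) (by linarith)
  have hsd : 0 < r d * Real.sin (θ d) := by
    rw [hd', hγ1]
    exact div_pos (by simpa using hneg) (by linarith)
  have hθc_le : θ c ≤ θ₀ := hθ0 ▸ hθanti (left_mem_Icc.2 zero_le_one) hcI hcI.1
  have hθd_ge : -θL ≤ θ d := hθ1 ▸ hθanti hdI (right_mem_Icc.2 zero_le_one) hdI.2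
  have hθc : θ c < 0 := by
    by_contra! h
    have := Real.sin_nonneg_of_nonneg_of_le_pi h (by linarith [hθ₀.2, Real.pi_pos])
    exact hsc.not_ge (mul_nonneg (hr c hcI).le this)
  have hθd : 0 < θ d := by
    by_contra! h
    have := Real.sin_nonpos_of_nonpos_of_neg_pi_le h (by linarith [hθL.2, Real.pi_pos])
    exact hsd.not_ge (mul_nonpos_of_nonneg_of_nonpos (hr d hdI).le this)
  linarith [hθanti hcI hdI (hc.2.trans hd.1).le]
end

section
/- Under the monotone-tangent-angle hypotheses on γ, the whole curve lies in the closed bounding triangle determined by the chord from (0,0) to (L,0) and the base angles θ₀ and θ_L: for every t ∈ [0,1], writing γ(t) = (x(t), y(t)), one has y(t) ≥ 0, sin(θ₀)·x(t) − cos(θ₀)·y(t) ≥ 0, and sin(θ_L)·(L − x(t)) − cos(θ_L)·y(t) ≥ 0. -/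
open Real Set

/-- A function with nonnegative derivative on `[a, b]` satisfies `f a ≤ f b`; the derivative may be
taken within any larger set. -/
theorem le_of_hasDerivWithinAt_nonneg_Icc {f f' : ℝ → ℝ} {s : Set ℝ} {a b : ℝ} (hab : a ≤ b)
    (hs : Icc a b ⊆ s) (hf : ∀ t ∈ Icc a b, HasDerivWithinAt f (f' t) s t)
    (hf' : ∀ t ∈ Icc a b, 0 ≤ f' t) : f a ≤ f b := by
  have hmono : MonotoneOn f (Icc a b) :=
    monotoneOn_of_hasDerivWithinAt_nonneg (f' := f') (convex_Icc a b)
      (fun t ht => ((hf t ht).mono hs).continuousWithinAt)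
      (fun t ht => (hf t (interior_subset ht)).mono (interior_subset.trans hs))
      (fun t ht => hf' t (interior_subset ht))
  exact hmono (left_mem_Icc.2 hab) (right_mem_Icc.2 hab) hab

theorem curve_in_bounding_triangle
    (L θ₀ θL : ℝ) (hL : 0 < L)
    (hθ₀ : θ₀ ∈ Icc (0 : ℝ) (π / 2)) (hθL : θL ∈ Icc (0 : ℝ) (π / 2))
    (γ : ℝ → ℝ × ℝ) (r θ : ℝ → ℝ)
    (hγ0 : γ 0 = (0, 0)) (hγ1 : γ 1 = (L, 0))
    (hr : ∀ t ∈ Icc (0 : ℝ) 1, 0 < r t)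
    (hθanti : AntitoneOn θ (Icc (0 : ℝ) 1))
    (hθ0 : θ 0 = θ₀) (hθ1 : θ 1 = -θL)
    (hderiv : ∀ t ∈ Icc (0 : ℝ) 1,
      HasDerivWithinAt γ (r t • (Real.cos (θ t), Real.sin (θ t))) (Icc (0 : ℝ) 1) t) :
    ∀ t ∈ Icc (0 : ℝ) 1,
      (γ t).2 ≥ 0 ∧ Real.sin θ₀ * (γ t).1 - Real.cos θ₀ * (γ t).2 ≥ 0 ∧ Real.sin θL * (L - (γ t).1) - Real.cos θL * (γ t).2 ≥ 0 := by
  have h0 : (0 : ℝ) ∈ Icc (0 : ℝ) 1 := by simp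
  have h1 : (1 : ℝ) ∈ Icc (0 : ℝ) 1 := by simp
  have hle : ∀ t ∈ Icc (0 : ℝ) 1, θ t ≤ θ₀ := fun t ht => hθ0 ▸ hθanti h0 ht ht.1
  have hge : ∀ t ∈ Icc (0 : ℝ) 1, -θL ≤ θ t := fun t ht => hθ1 ▸ hθanti ht h1 ht.2
  have hx : ∀ t ∈ Icc (0 : ℝ) 1,
      HasDerivWithinAt (fun u => (γ u).1) (r t * Real.cos (θ t)) (Icc (0 : ℝ) 1) t :=
    fun t ht => (hderiv t ht).fst
  have hy : ∀ t ∈ Icc (0 : ℝ) 1,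
      HasDerivWithinAt (fun u => (γ u).2) (r t * Real.sin (θ t)) (Icc (0 : ℝ) 1) t :=
    fun t ht => (hderiv t ht).snd
  obtain ⟨hθ₀0, hθ₀π⟩ := hθ₀
  obtain ⟨hθL0, hθLπ⟩ := hθL
  intro t ht
  have hl : Icc 0 t ⊆ Icc (0 : ℝ) 1 := Icc_subset_Icc_right ht.2
  have hr' : Icc t 1 ⊆ Icc (0 : ℝ) 1 := Icc_subset_Icc_left ht.1
  refine ⟨?_, ?_, ?_⟩
  · rcases le_total 0 (θ t) with h | h
    · have key := le_of_hasDerivWithinAt_nonneg_Icc ht.1 hl (fun u hu => hy u (hl hu))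
        fun u hu => mul_nonneg (hr u (hl hu)).le <| Real.sin_nonneg_of_nonneg_of_le_pi
          (h.trans (hθanti (hl hu) ht hu.2)) (by linarith [hle u (hl hu)])
      simpa [hγ0] using key
    · have key := le_of_hasDerivWithinAt_nonneg_Icc ht.2 hr' (fun u hu => (hy u (hr' hu)).neg)
        fun u hu => neg_nonneg.2 <| mul_nonpos_of_nonneg_of_nonpos (hr u (hr' hu)).le <|
          Real.sin_nonpos_of_nonpos_of_neg_pi_le
            ((hθanti ht (hr' hu) hu.1).trans h) (by linarith [hge u (hr' hu)])
      simpa [hγ1] using key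
  · have key := le_of_hasDerivWithinAt_nonneg_Icc ht.1 hl
      (fun u hu => ((hx u (hl hu)).const_mul (Real.sin θ₀)).sub
        ((hy u (hl hu)).const_mul (Real.cos θ₀)))
      fun u hu => by
        have hsin : 0 ≤ Real.sin (θ₀ - θ u) := Real.sin_nonneg_of_nonneg_of_le_pi
          (by linarith [hle u (hl hu)]) (by linarith [hge u (hl hu)])
        rw [Real.sin_sub] at hsin
        linarith [mul_nonneg (hr u (hl hu)).le hsin]
    simpa [hγ0] using key
  · have key := le_of_hasDerivWithinAt_nonneg_Icc ht.2 hr'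
      (fun u hu => ((hx u (hr' hu)).const_mul (Real.sin θL)).add
        ((hy u (hr' hu)).const_mul (Real.cos θL)))
      fun u hu => by
        have hsin : 0 ≤ Real.sin (θL + θ u) := Real.sin_nonneg_of_nonneg_of_le_pi
          (by linarith [hge u (hr' hu)]) (by linarith [hle u (hr' hu)])
        rw [Real.sin_add] at hsin
        linarith [mul_nonneg (hr u (hr' hu)).le hsin]
    simp only [Pi.add_apply, hγ1] at key
    linarith
end
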